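/- arXiv:2305.10392 — 4 statements merged into one kernel-verified Lean document; each statement's English description precedes it below -/
import Mathlib

section
/- For every discount factor α ∈ (0,1), every n ≥ 0, every b ∈ {0,1}, and all positive integers v1, v2 with v2 ≤ v1 and all non-negative integers x, y with v2 + y ≤ v1 + x, the value-iteration functions satisfy V_{α,n}((v1, v2, b)) ≤ V_{α,n}((v1+x, v2+y, b)). (n-step form of Lemma 3, first part.) -/
/-!
Re-transmission MDP: states `(v1, v2, b)` with `v1 : ℕ` (age at the user, `≥ 1`),
`v2 : Option ℕ` (age of the packet at the BS; `none` means empty queue, i.e. `∞`),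
`b : Bool` (fresh packet available).  Value iteration `Viter p q1 q2 α n v1 v2 b`
implements `V_{α,n}` as in the paper.
-/

noncomputable section

/-- Q-value of action `0` (re-transmit the old packet of age `k`) with continuation `W`. -/
def Qact0 (p q2 α : ℝ) (W : ℕ → Option ℕ → Bool → ℝ) (v1 k : ℕ) : ℝ :=
  q2 * ((k : ℝ) + 1) + (1 - q2) * ((v1 : ℝ) + 1)
    + α * (p * (1 - q2) * W (v1 + 1) (some (k + 1)) true
      + (1 - p) * (1 - q2) * W (v1 + 1) (some (k + 1)) false
      + (1 - p) * q2 * W (k + 1) none false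
      + p * q2 * W (k + 1) none true)

/-- Q-value of action `1` (transmit the fresh packet) with continuation `W`. -/
def Qact1 (p q1 α : ℝ) (W : ℕ → Option ℕ → Bool → ℝ) (v1 : ℕ) : ℝ :=
  q1 * 1 + (1 - q1) * ((v1 : ℝ) + 1)
    + α * (p * (1 - q1) * W (v1 + 1) (some 1) true
      + (1 - p) * (1 - q1) * W (v1 + 1) (some 1) false
      + (1 - p) * q1 * W 1 none false
      + p * q1 * W 1 none true)

/-- Q-value of action `2` (idle, empty queue) with continuation `W`. -/
def Qact2 (p α : ℝ) (W : ℕ → Option ℕ → Bool → ℝ) (v1 : ℕ) : ℝ :=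
  ((v1 : ℝ) + 1)
    + α * ((1 - p) * W (v1 + 1) none false + p * W (v1 + 1) none true)

/-- Value iteration `V_{α,n}` for the re-transmission MDP: `V_{α,0} = 0` and
`V_{α,n}(s) = min` over feasible actions of the corresponding Q-value. -/
def Viter (p q1 q2 α : ℝ) : ℕ → ℕ → Option ℕ → Bool → ℝ
  | 0 => fun _ _ _ => 0
  | n + 1 => fun v1 v2 b =>
      match v2, b with
      | none, false => Qact2 p α (Viter p q1 q2 α n) v1
      | none, true => Qact1 p q1 α (Viter p q1 q2 α n) v1
      | some k, false => Qact0 p q2 α (Viter p q1 q2 α n) v1 k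
      | some k, true =>
          min (Qact0 p q2 α (Viter p q1 q2 α n) v1 k)
            (Qact1 p q1 α (Viter p q1 q2 α n) v1)

end

theorem viter_mono_aux (p q1 q2 α : ℝ)
    (hp0 : 0 ≤ p) (hp1 : 0 ≤ 1 - p) (hq10 : 0 ≤ q1) (hq11 : 0 ≤ 1 - q1)
    (hq20 : 0 ≤ q2) (hq21 : 0 ≤ 1 - q2) (hα0 : 0 ≤ α) (n : ℕ) :
    (∀ b : Bool, ∀ v w k l : ℕ, v ≤ w → k ≤ l →
      Viter p q1 q2 α n v (some k) b ≤ Viter p q1 q2 α n w (some l) b) ∧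
    (∀ b : Bool, ∀ v w : ℕ, v ≤ w →
      Viter p q1 q2 α n v none b ≤ Viter p q1 q2 α n w none b) := by
  induction n with
  | zero => simp [Viter]
  | succ n ih =>
    obtain ⟨hS, hN⟩ := ih
    have h0 : ∀ v w k l : ℕ, v ≤ w → k ≤ l →
        Qact0 p q2 α (Viter p q1 q2 α n) v k ≤ Qact0 p q2 α (Viter p q1 q2 α n) w l := by
      intro v w k l hvw hkl
      have hS' := fun b => hS b (v + 1) (w + 1) (k + 1) (l + 1) (by omega) (by omega)
      have hN' := fun b => hN b (k + 1) (l + 1) (by omega)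
      unfold Qact0
      gcongr <;> first | exact hS' _ | exact hN' _
    have h1 : ∀ v w : ℕ, v ≤ w →
        Qact1 p q1 α (Viter p q1 q2 α n) v ≤ Qact1 p q1 α (Viter p q1 q2 α n) w := by
      intro v w hvw
      have hS' := fun b => hS b (v + 1) (w + 1) 1 1 (by omega) le_rfl
      unfold Qact1
      gcongr <;> exact hS' _
    have h2 : ∀ v w : ℕ, v ≤ w →
        Qact2 p α (Viter p q1 q2 α n) v ≤ Qact2 p α (Viter p q1 q2 α n) w := by
      intro v w hvw
      have hN' := fun b => hN b (v + 1) (w + 1) (by omega)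
      unfold Qact2
      gcongr <;> exact hN' _
    refine ⟨?_, ?_⟩
    · rintro (_ | _) v w k l hvw hkl
      · exact h0 v w k l hvw hkl
      · exact min_le_min (h0 v w k l hvw hkl) (h1 v w hvw)
    · rintro (_ | _) v w hvw
      · exact h2 v w hvw
      · exact h1 v w hvw

/-- n-step form of Lemma 3, first part: monotonicity of the value-iteration
functions in `(v1, v2)` for states with a packet in the queue. -/
theorem viter_monotone_in_state (p q1 q2 α : ℝ)
    (hp0 : 0 < p) (hp1 : p ≤ 1) (hq10 : 0 < q1) (hq12 : q1 < q2) (hq21 : q2 < 1)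
    (hα0 : 0 < α) (hα1 : α < 1)
    (n : ℕ) (b : Bool) (v1 v2 x y : ℕ)
    (hv1 : 1 ≤ v1) (hv2 : 1 ≤ v2) (h21 : v2 ≤ v1) (h21' : v2 + y ≤ v1 + x) :
    Viter p q1 q2 α n v1 (some v2) b ≤ Viter p q1 q2 α n (v1 + x) (some (v2 + y)) b := by
  exact (viter_mono_aux p q1 q2 α hp0.le (by linarith) hq10.le (by linarith) (by linarith)
    (by linarith) hα0.le n).1 b v1 (v1 + x) v2 (v2 + y) (by omega) (by omega)
end

section
/- For every discount factor α ∈ (0,1) and every b ∈ {0,1}: (i) for all positive integers v1, v2 with v2 ≤ v1 and all non-negative integers x, y with v2 + y ≤ v1 + x, V_α((v1, v2, b)) ≤ V_α((v1+x, v2+y, b)); and (ii) for every positive integer v1 and non-negative integer x, V_α((v1, ∞, b)) ≤ V_α((v1+x, ∞, b)). (Lemma 3.) -/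
/-- The discounted value function `V_α(s) = sup_n V_{α,n}(s)`. -/
noncomputable def Vdisc (p q1 q2 α : ℝ) (v1 : ℕ) (v2 : Option ℕ) (b : Bool) : ℝ :=
  ⨆ n : ℕ, Viter p q1 q2 α n v1 v2 b

lemma avg_mono {p q a b c d a' b' c' d' : ℝ} (hp0 : 0 ≤ p) (hp1 : p ≤ 1) (hq0 : 0 ≤ q) (hq1 : q ≤ 1)
    (ha : a ≤ a') (hb : b ≤ b') (hc : c ≤ c') (hd : d ≤ d') :
    p * (1 - q) * a + (1 - p) * (1 - q) * b + (1 - p) * q * c + p * q * d ≤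
      p * (1 - q) * a' + (1 - p) * (1 - q) * b' + (1 - p) * q * c' + p * q * d' := by
  have h1 : 0 ≤ 1 - p := by linarith
  have h2 : 0 ≤ 1 - q := by linarith
  gcongr

lemma avg_le {p q a b c d M : ℝ} (hp0 : 0 ≤ p) (hp1 : p ≤ 1) (hq0 : 0 ≤ q) (hq1 : q ≤ 1)
    (ha : a ≤ M) (hb : b ≤ M) (hc : c ≤ M) (hd : d ≤ M) :
    p * (1 - q) * a + (1 - p) * (1 - q) * b + (1 - p) * q * c + p * q * d ≤ M :=
  (avg_mono hp0 hp1 hq0 hq1 ha hb hc hd).trans (le_of_eq (by ring))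

lemma viter_mono (p q1 q2 α : ℝ)
    (hp0 : 0 < p) (hp1 : p ≤ 1) (hq10 : 0 < q1) (hq12 : q1 < q2) (hq21 : q2 < 1)
    (hα0 : 0 < α) (n : ℕ) :
    (∀ v w k l : ℕ, ∀ b, v ≤ w → k ≤ l →
      Viter p q1 q2 α n v (some k) b ≤ Viter p q1 q2 α n w (some l) b) ∧
    (∀ v w : ℕ, ∀ b, v ≤ w → Viter p q1 q2 α n v none b ≤ Viter p q1 q2 α n w none b) := by
  induction n with
  | zero => simp [Viter]
  | succ n ih =>
    obtain ⟨h1, h2⟩ := ih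
    have e0 : ∀ v w k l : ℕ, v ≤ w → k ≤ l →
        Qact0 p q2 α (Viter p q1 q2 α n) v k ≤ Qact0 p q2 α (Viter p q1 q2 α n) w l := by
      intro v w k l hv hk
      have hv' : (v : ℝ) ≤ w := by exact_mod_cast hv
      have hk' : (k : ℝ) ≤ l := by exact_mod_cast hk
      have q0 : 0 ≤ q2 := by linarith
      have q0' : 0 ≤ 1 - q2 := by linarith
      have := avg_mono hp0.le hp1 q0 hq21.le
        (h1 (v+1) (w+1) (k+1) (l+1) true (by omega) (by omega))
        (h1 (v+1) (w+1) (k+1) (l+1) false (by omega) (by omega))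
        (h2 (k+1) (l+1) false (by omega)) (h2 (k+1) (l+1) true (by omega))
      unfold Qact0
      exact add_le_add (by gcongr) (mul_le_mul_of_nonneg_left this hα0.le)
    have e1 : ∀ v w : ℕ, v ≤ w →
        Qact1 p q1 α (Viter p q1 q2 α n) v ≤ Qact1 p q1 α (Viter p q1 q2 α n) w := by
      intro v w hv
      have hv' : (v : ℝ) ≤ w := by exact_mod_cast hv
      have q0' : 0 ≤ 1 - q1 := by linarith
      have := avg_mono hp0.le hp1 hq10.le (by linarith : q1 ≤ 1)
        (h1 (v+1) (w+1) 1 1 true (by omega) le_rfl)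
        (h1 (v+1) (w+1) 1 1 false (by omega) le_rfl)
        (h2 1 1 false le_rfl) (h2 1 1 true le_rfl)
      unfold Qact1
      exact add_le_add (by gcongr) (mul_le_mul_of_nonneg_left this hα0.le)
    refine ⟨?_, ?_⟩
    · intro v w k l b hv hk
      cases b
      · exact e0 v w k l hv hk
      · exact min_le_min (e0 v w k l hv hk) (e1 v w hv)
    · intro v w b hv
      cases b
      · have hv' : (v : ℝ) ≤ w := by exact_mod_cast hv
        have a1 := h2 (v+1) (w+1) false (by omega)
        have a2 := h2 (v+1) (w+1) true (by omega)
        have q0' : 0 ≤ 1 - p := by linarith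
        change Qact2 _ _ _ _ ≤ Qact2 _ _ _ _
        unfold Qact2
        gcongr
      · exact e1 v w hv

lemma viter_bound (p q1 q2 α c : ℝ)
    (hp0 : 0 < p) (hp1 : p ≤ 1) (hq10 : 0 < q1) (hq12 : q1 < q2) (hq21 : q2 < 1)
    (hα0 : 0 < α) (hα1 : α < 1) (hc0 : 0 < c) (hc : c * (1 - α) = 1) (n : ℕ) :
    (∀ v k : ℕ, ∀ b, Viter p q1 q2 α n v (some k) b ≤ c * ((v : ℝ) + k + 1 + 2 * c)) ∧
    (∀ v : ℕ, ∀ b, Viter p q1 q2 α n v none b ≤ c * ((v : ℝ) + 1 + 2 * c)) := by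
  have step : ∀ m X : ℝ, X ≤ c * (m + 2 + 1 + 2 * c) →
      m + 1 + α * X ≤ c * (m + 1 + 2 * c) := by
    intro m X hX
    have h3 := mul_le_mul_of_nonneg_left hX hα0.le
    have e : c * (m + 1 + 2 * c) - α * (c * (m + 2 + 1 + 2 * c))
        = (c * (1 - α)) * (m + 1 + 2 * c) - 2 * (α * c) := by ring
    rw [hc] at e
    nlinarith
  induction n with
  | zero =>
    refine ⟨fun v k b => ?_, fun v b => ?_⟩ <;> simp only [Viter] <;> positivity
  | succ n ih =>
    obtain ⟨h1, h2⟩ := ih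
    have e0 : ∀ v k : ℕ,
        Qact0 p q2 α (Viter p q1 q2 α n) v k ≤ c * ((v : ℝ) + k + 1 + 2 * c) := by
      intro v k
      have hv : (0 : ℝ) ≤ v := v.cast_nonneg
      have hk : (0 : ℝ) ≤ k := k.cast_nonneg
      have q0 : 0 ≤ q2 := by linarith
      have a1 : ∀ b, Viter p q1 q2 α n (v+1) (some (k+1)) b
          ≤ c * ((v : ℝ) + k + 2 + 1 + 2 * c) := fun b =>
        (h1 (v+1) (k+1) b).trans (by push_cast; gcongr ?_ * ?_; linarith)
      have a2 : ∀ b, Viter p q1 q2 α n (k+1) none b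
          ≤ c * ((v : ℝ) + k + 2 + 1 + 2 * c) := fun b =>
        (h2 (k+1) b).trans (by push_cast; gcongr ?_ * ?_; linarith)
      have := step _ _ (avg_le hp0.le hp1 q0 hq21.le (a1 true) (a1 false) (a2 false) (a2 true))
      refine le_trans ?_ this
      unfold Qact0
      gcongr ?_ + _
      nlinarith
    have e1 : ∀ v : ℕ,
        Qact1 p q1 α (Viter p q1 q2 α n) v ≤ c * ((v : ℝ) + 1 + 2 * c) := by
      intro v
      have hv : (0 : ℝ) ≤ v := v.cast_nonneg
      have a1 : ∀ b, Viter p q1 q2 α n (v+1) (some 1) b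
          ≤ c * ((v : ℝ) + 2 + 1 + 2 * c) := fun b =>
        (h1 (v+1) 1 b).trans (by push_cast; gcongr ?_ * ?_; linarith)
      have a2 : ∀ b, Viter p q1 q2 α n 1 none b
          ≤ c * ((v : ℝ) + 2 + 1 + 2 * c) := fun b =>
        (h2 1 b).trans (by push_cast; gcongr ?_ * ?_; linarith)
      have := step _ _ (avg_le hp0.le hp1 hq10.le (by linarith : q1 ≤ 1)
        (a1 true) (a1 false) (a2 false) (a2 true))
      refine le_trans ?_ this
      unfold Qact1
      gcongr ?_ + _
      nlinarith
    refine ⟨?_, ?_⟩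
    · intro v k b
      cases b
      · exact e0 v k
      · exact (min_le_left _ _).trans (e0 v k)
    · intro v b
      cases b
      · have a : ∀ b, Viter p q1 q2 α n (v+1) none b
            ≤ c * ((v : ℝ) + 2 + 1 + 2 * c) := fun b =>
          (h2 (v+1) b).trans (by push_cast; gcongr ?_ * ?_; linarith)
        have q0' : 0 ≤ 1 - p := by linarith
        refine step _ _ ?_
        have b1 := mul_le_mul_of_nonneg_left (a false) q0'
        have b2 := mul_le_mul_of_nonneg_left (a true) hp0.le
        linarith
      · exact e1 v

/-- Lemma 3: monotonicity of the discounted value function `V_α` in the state,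
both for states with a packet in the queue and for states with an empty queue. -/
theorem vdisc_monotone_in_state (p q1 q2 α : ℝ)
    (hp0 : 0 < p) (hp1 : p ≤ 1) (hq10 : 0 < q1) (hq12 : q1 < q2) (hq21 : q2 < 1)
    (hα0 : 0 < α) (hα1 : α < 1) (b : Bool) :
    (∀ v1 v2 x y : ℕ, 1 ≤ v1 → 1 ≤ v2 → v2 ≤ v1 → v2 + y ≤ v1 + x →
      Vdisc p q1 q2 α v1 (some v2) b ≤ Vdisc p q1 q2 α (v1 + x) (some (v2 + y)) b) ∧
    (∀ v1 x : ℕ, 1 ≤ v1 →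
      Vdisc p q1 q2 α v1 none b ≤ Vdisc p q1 q2 α (v1 + x) none b) := by
  have hc : (1 - α)⁻¹ * (1 - α) = 1 := inv_mul_cancel₀ (by linarith)
  have hc0 : 0 < (1 - α)⁻¹ := inv_pos.mpr (by linarith)
  have hb := viter_bound p q1 q2 α _ hp0 hp1 hq10 hq12 hq21 hα0 hα1 hc0 hc
  have hm := viter_mono p q1 q2 α hp0 hp1 hq10 hq12 hq21 hα0
  refine ⟨fun v1 v2 x y _ _ _ _ => ?_, fun v1 x _ => ?_⟩
  · refine ciSup_mono ⟨(1 - α)⁻¹ * (((v1 + x : ℕ) : ℝ) + (v2 + y : ℕ) + 1 + 2 * (1 - α)⁻¹), ?_⟩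
      (fun n => (hm n).1 _ _ _ _ b (by omega) (by omega))
    rintro _ ⟨n, rfl⟩
    exact (hb n).1 _ _ b
  · refine ciSup_mono ⟨(1 - α)⁻¹ * (((v1 + x : ℕ) : ℝ) + 1 + 2 * (1 - α)⁻¹), ?_⟩
      (fun n => (hm n).2 _ _ b (by omega))
    rintro _ ⟨n, rfl⟩
    exact (hb n).2 _ b
end

section
/- Fix α ∈ (0,1), n ≥ 1, and positive integers v1, v2 with v2 ≤ v1. If V_{α,n}((v1, v2, 1); 1) ≤ V_{α,n}((v1, v2, 1); 0), then for every integer x with 0 ≤ x ≤ v1 − v2 we also have V_{α,n}((v1, v2+x, 1); 1) ≤ V_{α,n}((v1, v2+x, 1); 0). In words: if at (v1,v2,1) transmitting the fresh packet has n-step discounted Q-value no larger than re-transmitting, the same holds when the old packet is older. (n-step form of Lemma 4.) -/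
theorem Qact0_mono_aux (p q2 α : ℝ) (hp0 : 0 ≤ p) (hp1 : p ≤ 1) (hq0 : 0 ≤ q2) (hq1 : q2 ≤ 1)
    (hα : 0 ≤ α) (W : ℕ → Option ℕ → Bool → ℝ)
    (hN : ∀ a a' b, a ≤ a' → W a none b ≤ W a' none b)
    (hS : ∀ a a' k k' b, a ≤ a' → k ≤ k' → W a (some k) b ≤ W a' (some k') b)
    (a a' k k' : ℕ) (ha : a ≤ a') (hk : k ≤ k') :
    Qact0 p q2 α W a k ≤ Qact0 p q2 α W a' k' := by
  have h1 : 0 ≤ 1 - p := by linarith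
  have h2 : 0 ≤ 1 - q2 := by linarith
  have ha1 : a + 1 ≤ a' + 1 := by omega
  have hk1 : k + 1 ≤ k' + 1 := by omega
  have haR : (a : ℝ) ≤ a' := by exact_mod_cast ha
  have hkR : (k : ℝ) ≤ k' := by exact_mod_cast hk
  have e1 := hS _ _ _ _ true ha1 hk1
  have e2 := hS _ _ _ _ false ha1 hk1
  have e3 := hN _ _ true hk1
  have e4 := hN _ _ false hk1
  unfold Qact0
  gcongr

theorem Qact1_mono_aux (p q1 α : ℝ) (hp0 : 0 ≤ p) (hp1 : p ≤ 1) (hq0 : 0 ≤ q1) (hq1 : q1 ≤ 1)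
    (hα : 0 ≤ α) (W : ℕ → Option ℕ → Bool → ℝ)
    (hS : ∀ a a' k k' b, a ≤ a' → k ≤ k' → W a (some k) b ≤ W a' (some k') b)
    (a a' : ℕ) (ha : a ≤ a') :
    Qact1 p q1 α W a ≤ Qact1 p q1 α W a' := by
  have h1 : 0 ≤ 1 - p := by linarith
  have h2 : 0 ≤ 1 - q1 := by linarith
  have ha1 : a + 1 ≤ a' + 1 := by omega
  have haR : (a : ℝ) ≤ a' := by exact_mod_cast ha
  have e1 := hS _ _ 1 1 true ha1 le_rfl
  have e2 := hS _ _ 1 1 false ha1 le_rfl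
  unfold Qact1
  gcongr

theorem Qact2_mono_aux (p α : ℝ) (hp0 : 0 ≤ p) (hp1 : p ≤ 1)
    (hα : 0 ≤ α) (W : ℕ → Option ℕ → Bool → ℝ)
    (hN : ∀ a a' b, a ≤ a' → W a none b ≤ W a' none b)
    (a a' : ℕ) (ha : a ≤ a') :
    Qact2 p α W a ≤ Qact2 p α W a' := by
  have h1 : 0 ≤ 1 - p := by linarith
  have ha1 : a + 1 ≤ a' + 1 := by omega
  have haR : (a : ℝ) ≤ a' := by exact_mod_cast ha
  have e1 := hN _ _ true ha1
  have e2 := hN _ _ false ha1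
  unfold Qact2
  gcongr

theorem Viter_mono_aux (p q1 q2 α : ℝ) (hp0 : 0 ≤ p) (hp1 : p ≤ 1) (hq10 : 0 ≤ q1) (hq11 : q1 ≤ 1)
    (hq20 : 0 ≤ q2) (hq21 : q2 ≤ 1) (hα : 0 ≤ α) (n : ℕ) :
    (∀ a a' b, a ≤ a' → Viter p q1 q2 α n a none b ≤ Viter p q1 q2 α n a' none b) ∧
    (∀ a a' k k' b, a ≤ a' → k ≤ k' →
      Viter p q1 q2 α n a (some k) b ≤ Viter p q1 q2 α n a' (some k') b) := by
  induction n with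
  | zero => simp [Viter]
  | succ n ih =>
    obtain ⟨hN, hS⟩ := ih
    refine ⟨?_, ?_⟩
    · intro a a' b ha
      cases b
      · exact Qact2_mono_aux p α hp0 hp1 hα _ hN a a' ha
      · exact Qact1_mono_aux p q1 α hp0 hp1 hq10 hq11 hα _ hS a a' ha
    · intro a a' k k' b ha hk
      have e0 := Qact0_mono_aux p q2 α hp0 hp1 hq20 hq21 hα _ hN hS a a' k k' ha hk
      cases b
      · exact e0
      · exact min_le_min e0 (Qact1_mono_aux p q1 α hp0 hp1 hq10 hq11 hα _ hS a a' ha)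

/-- n-step form of Lemma 4: if at `(v1, v2, 1)` the `n`-step Q-value of transmitting
the fresh packet (`V_{α,n}(s;1) = Qact1` applied to `V_{α,n-1}`) is no larger than that
of re-transmitting (`V_{α,n}(s;0)`), the same holds when the old packet is older,
i.e. at `(v1, v2 + x, 1)` for `0 ≤ x ≤ v1 − v2`. -/
theorem qval_switch_structure_nstep (p q1 q2 α : ℝ)
    (hp0 : 0 < p) (hp1 : p ≤ 1) (hq10 : 0 < q1) (hq12 : q1 < q2) (hq21 : q2 < 1)
    (hα0 : 0 < α) (hα1 : α < 1)
    (n : ℕ) (hn : 1 ≤ n) (v1 v2 : ℕ) (hv1 : 1 ≤ v1) (hv2 : 1 ≤ v2) (h21 : v2 ≤ v1)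
    (h : Qact1 p q1 α (Viter p q1 q2 α (n - 1)) v1
        ≤ Qact0 p q2 α (Viter p q1 q2 α (n - 1)) v1 v2)
    (x : ℕ) (hx : v2 + x ≤ v1) :
    Qact1 p q1 α (Viter p q1 q2 α (n - 1)) v1
      ≤ Qact0 p q2 α (Viter p q1 q2 α (n - 1)) v1 (v2 + x) := by
  obtain ⟨hN, hS⟩ := Viter_mono_aux p q1 q2 α hp0.le hp1 hq10.le (by linarith) (by linarith)
    hq21.le hα0.le (n - 1)
  exact h.trans (Qact0_mono_aux p q2 α hp0.le hp1 (by linarith) hq21.le hα0.le _ hN hS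
    v1 v1 v2 (v2 + x) le_rfl (by omega))
end

section
/- For every α ∈ (0,1), every n ≥ 0, every b ∈ {0,1}, and every real v2 ≥ 1 (including v2 = ∞), the map v1 ↦ V̄_{α,n}((v1, v2, b)) is concave on the interval of admissible v1 (i.e., on [v2, ∞) when v2 < ∞, and on [1, ∞) when v2 = ∞). Consequently the pointwise limit V̄_α((v1,v2,b)) = sup_n V̄_{α,n}((v1,v2,b)) is also concave in v1 on the same interval. (Lemma 6.) -/
/-!
Continuous-state re-transmission MDP `Δ̄`: states `(v1, v2, b)` with `v1 : ℝ` (age at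
the user, `≥ 1`), `v2 : Option ℝ` (age of the packet at the BS; `none` = empty queue),
`b : Bool`.  Value iteration `VbarIter p q1 q2 α n v1 v2 b` implements `V̄_{α,n}`.
-/

noncomputable section

/-- Q-value of action `0` (re-transmit the old packet of age `k`) with continuation `W`. -/
def QbarAct0 (p q2 α : ℝ) (W : ℝ → Option ℝ → Bool → ℝ) (v1 k : ℝ) : ℝ :=
  q2 * (k + 1) + (1 - q2) * (v1 + 1)
    + α * (p * (1 - q2) * W (v1 + 1) (some (k + 1)) true
      + (1 - p) * (1 - q2) * W (v1 + 1) (some (k + 1)) false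
      + (1 - p) * q2 * W (k + 1) none false
      + p * q2 * W (k + 1) none true)

/-- Q-value of action `1` (transmit the fresh packet) with continuation `W`. -/
def QbarAct1 (p q1 α : ℝ) (W : ℝ → Option ℝ → Bool → ℝ) (v1 : ℝ) : ℝ :=
  q1 * 1 + (1 - q1) * (v1 + 1)
    + α * (p * (1 - q1) * W (v1 + 1) (some 1) true
      + (1 - p) * (1 - q1) * W (v1 + 1) (some 1) false
      + (1 - p) * q1 * W 1 none false
      + p * q1 * W 1 none true)

/-- Q-value of action `2` (idle, empty queue) with continuation `W`. -/
def QbarAct2 (p α : ℝ) (W : ℝ → Option ℝ → Bool → ℝ) (v1 : ℝ) : ℝ :=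
  (v1 + 1)
    + α * ((1 - p) * W (v1 + 1) none false + p * W (v1 + 1) none true)

/-- Value iteration `V̄_{α,n}` for the continuous-state re-transmission MDP `Δ̄`. -/
def VbarIter (p q1 q2 α : ℝ) : ℕ → ℝ → Option ℝ → Bool → ℝ
  | 0 => fun _ _ _ => 0
  | n + 1 => fun v1 v2 b =>
      match v2, b with
      | none, false => QbarAct2 p α (VbarIter p q1 q2 α n) v1
      | none, true => QbarAct1 p q1 α (VbarIter p q1 q2 α n) v1
      | some k, false => QbarAct0 p q2 α (VbarIter p q1 q2 α n) v1 k
      | some k, true =>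
          min (QbarAct0 p q2 α (VbarIter p q1 q2 α n) v1 k)
            (QbarAct1 p q1 α (VbarIter p q1 q2 α n) v1)

end

def ValidSt (v1 : ℝ) (v2 : Option ℝ) : Prop :=
  1 ≤ v1 ∧ ∀ k, v2 = some k → 1 ≤ k ∧ k ≤ v1

theorem act0_mono {p q2 α : ℝ} (hp0 : 0 < p) (hp1 : p ≤ 1) (hq0 : 0 < q2) (hq1 : q2 < 1)
    (hα0 : 0 < α) {W W' : ℝ → Option ℝ → Bool → ℝ}
    (h : ∀ v1 v2 b, ValidSt v1 v2 → W v1 v2 b ≤ W' v1 v2 b) {v1 k : ℝ} (hk : 1 ≤ k)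
    (hkv : k ≤ v1) : QbarAct0 p q2 α W v1 k ≤ QbarAct0 p q2 α W' v1 k := by
  have s1 : ValidSt (v1 + 1) (some (k + 1)) :=
    ⟨by linarith, fun j hj => by cases hj; constructor <;> linarith⟩
  have s2 : ValidSt (k + 1) none := ⟨by linarith, fun j hj => by cases hj⟩
  have := h _ _ true s1
  have := h _ _ false s1
  have := h _ _ true s2
  have := h _ _ false s2
  have : 0 ≤ 1 - p := by linarith
  have : 0 ≤ 1 - q2 := by linarith
  unfold QbarAct0
  gcongr

theorem act1_mono {p q1 α : ℝ} (hp0 : 0 < p) (hp1 : p ≤ 1) (hq0 : 0 < q1) (hq1 : q1 < 1)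
    (hα0 : 0 < α) {W W' : ℝ → Option ℝ → Bool → ℝ}
    (h : ∀ v1 v2 b, ValidSt v1 v2 → W v1 v2 b ≤ W' v1 v2 b) {v1 : ℝ} (hk : 1 ≤ v1) :
    QbarAct1 p q1 α W v1 ≤ QbarAct1 p q1 α W' v1 := by
  have s1 : ValidSt (v1 + 1) (some 1) :=
    ⟨by linarith, fun j hj => by cases hj; constructor <;> linarith⟩
  have s2 : ValidSt 1 none := ⟨by linarith, fun j hj => by cases hj⟩
  have := h _ _ true s1
  have := h _ _ false s1
  have := h _ _ true s2
  have := h _ _ false s2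
  have : 0 ≤ 1 - p := by linarith
  have : 0 ≤ 1 - q1 := by linarith
  unfold QbarAct1
  gcongr

theorem act2_mono {p α : ℝ} (hp0 : 0 < p) (hp1 : p ≤ 1)
    (hα0 : 0 < α) {W W' : ℝ → Option ℝ → Bool → ℝ}
    (h : ∀ v1 v2 b, ValidSt v1 v2 → W v1 v2 b ≤ W' v1 v2 b) {v1 : ℝ} (hk : 1 ≤ v1) :
    QbarAct2 p α W v1 ≤ QbarAct2 p α W' v1 := by
  have s1 : ValidSt (v1 + 1) none := ⟨by linarith, fun j hj => by cases hj⟩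
  have := h _ _ true s1
  have := h _ _ false s1
  have : 0 ≤ 1 - p := by linarith
  unfold QbarAct2
  gcongr

theorem vbar_mono_step (p q1 q2 α : ℝ)
    (hp0 : 0 < p) (hp1 : p ≤ 1) (hq10 : 0 < q1) (hq12 : q1 < q2) (hq21 : q2 < 1)
    (hα0 : 0 < α) (n : ℕ) : ∀ v1 v2 b, ValidSt v1 v2 →
      VbarIter p q1 q2 α n v1 v2 b ≤ VbarIter p q1 q2 α (n + 1) v1 v2 b := by
  have hq20 : 0 < q2 := by linarith
  have hq11 : q1 < 1 := by linarith
  induction n with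
  | zero =>
    rintro v1 (_ | k) (_ | _) ⟨h1, h2⟩
    · simp only [VbarIter, QbarAct2]; linarith
    · simp only [VbarIter, QbarAct1]; nlinarith
    · have := h2 k rfl
      simp only [VbarIter, QbarAct0]; nlinarith
    · have := h2 k rfl
      simp only [VbarIter, QbarAct0, QbarAct1]
      apply le_min <;> nlinarith
  | succ n ih =>
    rintro v1 (_ | k) (_ | _) ⟨h1, h2⟩
    · exact act2_mono hp0 hp1 hα0 ih h1
    · exact act1_mono hp0 hp1 hq10 hq11 hα0 ih h1
    · exact act0_mono hp0 hp1 hq20 hq21 hα0 ih (h2 k rfl).1 (h2 k rfl).2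
    · exact min_le_min (act0_mono hp0 hp1 hq20 hq21 hα0 ih (h2 k rfl).1 (h2 k rfl).2)
        (act1_mono hp0 hp1 hq10 hq11 hα0 ih h1)

theorem vbar_bound (p q1 q2 α a d : ℝ)
    (hp0 : 0 < p) (hp1 : p ≤ 1) (hq10 : 0 < q1) (hq12 : q1 < q2) (hq21 : q2 < 1)
    (hα0 : 0 < α) (ha0 : 0 < a) (hd0 : 0 < d) (ha : 1 + α * a = a) (hd : a + α * d = d) (n : ℕ) :
    ∀ v1 v2 b, ValidSt v1 v2 → VbarIter p q1 q2 α n v1 v2 b ≤ a * v1 + d := by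
  have hq20 : 0 < q2 := by linarith
  have hq11 : q1 < 1 := by linarith
  induction n with
  | zero =>
    rintro v1 v2 b ⟨h1, h2⟩
    simp only [VbarIter]; nlinarith
  | succ n ih =>
    have e1 : ∀ v1, 1 ≤ v1 → QbarAct1 p q1 α (VbarIter p q1 q2 α n) v1 ≤ a * v1 + d := by
      intro v1 h1
      refine (act1_mono hp0 hp1 hq10 hq11 hα0 (W' := fun v _ _ => a * v + d) ih h1).trans ?_
      have : QbarAct1 p q1 α (fun v _ _ => a * v + d) v1 =
        (1 + α * a) * (v1 + 1 - q1 * v1) + α * d := by simp only [QbarAct1]; ring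
      rw [this, ha]
      nlinarith [mul_pos (mul_pos ha0 hq10) (by linarith : 0 < v1)]
    have e0 : ∀ v1 k, 1 ≤ k → k ≤ v1 →
        QbarAct0 p q2 α (VbarIter p q1 q2 α n) v1 k ≤ a * v1 + d := by
      intro v1 k h1 h2
      refine (act0_mono hp0 hp1 hq20 hq21 hα0 (W' := fun v _ _ => a * v + d) ih h1 h2).trans ?_
      have : QbarAct0 p q2 α (fun v _ _ => a * v + d) v1 k =
        (1 + α * a) * (v1 + 1 - q2 * (v1 - k)) + α * d := by simp only [QbarAct0]; ring
      rw [this, ha]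
      nlinarith [mul_nonneg (mul_pos ha0 hq20).le (by linarith : 0 ≤ v1 - k)]
    rintro v1 (_ | k) (_ | _) ⟨h1, h2⟩
    · refine (act2_mono hp0 hp1 hα0 (W' := fun v _ _ => a * v + d) ih h1).trans ?_
      have : QbarAct2 p α (fun v _ _ => a * v + d) v1 =
        (1 + α * a) * (v1 + 1) + α * d := by simp only [QbarAct2]; ring
      rw [this, ha]
      linarith
    · exact e1 v1 h1
    · exact e0 v1 k (h2 k rfl).1 (h2 k rfl).2
    · exact (min_le_right _ _).trans (e1 v1 h1)

theorem concave_shift {f : ℝ → ℝ} {c d : ℝ} (h : ConcaveOn ℝ (Set.Ici c) f) (hcd : c ≤ d + 1) :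
    ConcaveOn ℝ (Set.Ici d) (fun v => f (v + 1)) := by
  refine ⟨convex_Ici d, fun x hx y hy s t hs ht hst => ?_⟩
  simp only [Set.mem_Ici] at hx hy
  have := h.2 (x := x + 1) (y := y + 1) (by simp only [Set.mem_Ici]; linarith)
    (by simp only [Set.mem_Ici]; linarith) hs ht hst
  have e : s • x + t • y + 1 = s • (x + 1) + t • (y + 1) := by
    simp only [smul_eq_mul]; linear_combination -hst
  simpa only [e] using this

theorem concave_comb {f g : ℝ → ℝ} {S : Set ℝ} {A B r s c : ℝ} (hf : ConcaveOn ℝ S f)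
    (hg : ConcaveOn ℝ S g) (hr : 0 ≤ r) (hs : 0 ≤ s) :
    ConcaveOn ℝ S (fun v => A * v + B + (r * f v + s * g v) + c) := by
  refine ⟨hf.1, fun x hx y hy u w hu hw huw => ?_⟩
  have h1 := mul_le_mul_of_nonneg_left (hf.2 hx hy hu hw huw) hr
  have h2 := mul_le_mul_of_nonneg_left (hg.2 hx hy hu hw huw) hs
  simp only [smul_eq_mul] at *
  have : u * (A * x + B + (r * f x + s * g x) + c) + w * (A * y + B + (r * f y + s * g y) + c)
    = A * (u * x + w * y) + B + c + r * (u * f x + w * f y) + s * (u * g x + w * g y) := by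
    linear_combination (B + c) * huw
  linarith

theorem vbar_concave_n (p q1 q2 α : ℝ)
    (hp0 : 0 < p) (hp1 : p ≤ 1) (hq10 : 0 < q1) (hq12 : q1 < q2) (hq21 : q2 < 1)
    (hα0 : 0 < α) (n : ℕ) : ∀ (b : Bool) (v2 : ℝ), 1 ≤ v2 →
      ConcaveOn ℝ (Set.Ici v2) (fun v1 : ℝ => VbarIter p q1 q2 α n v1 (some v2) b) ∧
      ConcaveOn ℝ (Set.Ici (1 : ℝ)) (fun v1 : ℝ => VbarIter p q1 q2 α n v1 none b) := by
  have hq20 : 0 < q2 := by linarith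
  have hq11 : 0 ≤ 1 - q1 := by linarith
  have hq22 : 0 ≤ 1 - q2 := by linarith
  have hpp : 0 ≤ 1 - p := by linarith
  induction n with
  | zero =>
    intro b v2 _
    exact ⟨concaveOn_const 0 (convex_Ici _), concaveOn_const 0 (convex_Ici _)⟩
  | succ n ih =>
    set W := VbarIter p q1 q2 α n with hW
    have c1 : ConcaveOn ℝ (Set.Ici 1) (fun v => QbarAct1 p q1 α W v) := by
      have := concave_comb (A := 1 - q1) (B := q1 * 1 + (1 - q1))
        (c := α * ((1 - p) * q1 * W 1 none false + p * q1 * W 1 none true))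
        (r := α * (p * (1 - q1))) (s := α * ((1 - p) * (1 - q1)))
        (concave_shift (ih true 1 le_rfl).1 (by linarith : (1:ℝ) ≤ 1 + 1))
        (concave_shift (ih false 1 le_rfl).1 (by linarith : (1:ℝ) ≤ 1 + 1))
        (by positivity) (by positivity)
      convert this using 2
      simp only [QbarAct1]; ring
    have c2 : ConcaveOn ℝ (Set.Ici 1) (fun v => QbarAct2 p α W v) := by
      have := concave_comb (A := 1) (B := 1) (c := 0)
        (r := α * p) (s := α * (1 - p))
        (concave_shift (ih true 1 le_rfl).2 (by linarith : (1:ℝ) ≤ 1 + 1))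
        (concave_shift (ih false 1 le_rfl).2 (by linarith : (1:ℝ) ≤ 1 + 1))
        (by positivity) (by positivity)
      convert this using 2
      simp only [QbarAct2]; ring
    have c0 : ∀ k : ℝ, 1 ≤ k → ConcaveOn ℝ (Set.Ici k) (fun v => QbarAct0 p q2 α W v k) := by
      intro k hk
      have := concave_comb (A := 1 - q2) (B := q2 * (k + 1) + (1 - q2))
        (c := α * ((1 - p) * q2 * W (k + 1) none false + p * q2 * W (k + 1) none true))
        (r := α * (p * (1 - q2))) (s := α * ((1 - p) * (1 - q2)))
        (concave_shift (ih true (k + 1) (by linarith)).1 (le_refl (k + 1)))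
        (concave_shift (ih false (k + 1) (by linarith)).1 (le_refl (k + 1)))
        (by positivity) (by positivity)
      convert this using 2
      simp only [QbarAct0]; ring
    rintro (_ | _) v2 h2
    · exact ⟨c0 v2 h2, c2⟩
    · exact ⟨(c0 v2 h2).inf (c1.subset (Set.Ici_subset_Ici.2 h2) (convex_Ici _)), c1⟩

theorem concave_iSup {F : ℕ → ℝ → ℝ} {S : Set ℝ} (hS : Convex ℝ S)
    (hc : ∀ n, ConcaveOn ℝ S (F n)) (hm : ∀ x ∈ S, Monotone fun n => F n x)
    (hb : ∀ x ∈ S, BddAbove (Set.range fun n => F n x)) :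
    ConcaveOn ℝ S (fun x => ⨆ n, F n x) := by
  refine ⟨hS, fun x hx y hy s t hs ht hst => ?_⟩
  have tx := tendsto_atTop_ciSup (hm x hx) (hb x hx)
  have ty := tendsto_atTop_ciSup (hm y hy) (hb y hy)
  refine le_of_tendsto' ((tx.const_smul s).add (ty.const_smul t)) fun n => ?_
  exact ((hc n).2 hx hy hs ht hst).trans (le_ciSup (hb _ (hS hx hy hs ht hst)) n)

/-- Lemma 6: for every `n`, `b`, and admissible `v2` (a real `≥ 1`, or `∞ = none`),
the map `v1 ↦ V̄_{α,n}((v1, v2, b))` is concave on the interval of admissible `v1`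
(`[v2, ∞)` when `v2` is finite, `[1, ∞)` when `v2 = ∞`); consequently the pointwise
limit `V̄_α = sup_n V̄_{α,n}` is also concave in `v1` on the same interval. -/
theorem vbar_concave_in_v1 (p q1 q2 α : ℝ)
    (hp0 : 0 < p) (hp1 : p ≤ 1) (hq10 : 0 < q1) (hq12 : q1 < q2) (hq21 : q2 < 1)
    (hα0 : 0 < α) (hα1 : α < 1) :
    (∀ (n : ℕ) (b : Bool) (v2 : ℝ), 1 ≤ v2 →
      ConcaveOn ℝ (Set.Ici v2) (fun v1 : ℝ => VbarIter p q1 q2 α n v1 (some v2) b) ∧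
      ConcaveOn ℝ (Set.Ici (1 : ℝ)) (fun v1 : ℝ => VbarIter p q1 q2 α n v1 none b)) ∧
    (∀ (b : Bool) (v2 : ℝ), 1 ≤ v2 →
      ConcaveOn ℝ (Set.Ici v2)
        (fun v1 : ℝ => ⨆ n : ℕ, VbarIter p q1 q2 α n v1 (some v2) b) ∧
      ConcaveOn ℝ (Set.Ici (1 : ℝ))
        (fun v1 : ℝ => ⨆ n : ℕ, VbarIter p q1 q2 α n v1 none b)) := by
  have hc := fun n => vbar_concave_n p q1 q2 α hp0 hp1 hq10 hq12 hq21 hα0 n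
  have hm : ∀ v1 v2 b, ValidSt v1 v2 → Monotone fun n => VbarIter p q1 q2 α n v1 v2 b :=
    fun v1 v2 b hv => monotone_nat_of_le_succ fun n =>
      vbar_mono_step p q1 q2 α hp0 hp1 hq10 hq12 hq21 hα0 n v1 v2 b hv
  have h1 : 0 < 1 - α := by linarith
  have hb : ∀ v1 v2 b, ValidSt v1 v2 →
      BddAbove (Set.range fun n => VbarIter p q1 q2 α n v1 v2 b) := by
    intro v1 v2 b hv
    refine ⟨1 / (1 - α) * v1 + 1 / (1 - α) / (1 - α), ?_⟩
    rintro _ ⟨n, rfl⟩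
    exact vbar_bound p q1 q2 α _ _ hp0 hp1 hq10 hq12 hq21 hα0 (by positivity) (by positivity)
      (by field_simp; ring) (by field_simp; ring) n v1 v2 b hv
  refine ⟨hc, fun b v2 h2 => ⟨?_, ?_⟩⟩
  · have hv : ∀ x ∈ Set.Ici v2, ValidSt x (some v2) := fun x hx =>
      ⟨le_trans h2 hx, fun k hk => by cases hk; exact ⟨h2, hx⟩⟩
    exact concave_iSup (convex_Ici _) (fun n => (hc n b v2 h2).1)
      (fun x hx => hm x _ b (hv x hx)) (fun x hx => hb x _ b (hv x hx))
  · have hv : ∀ x ∈ Set.Ici (1 : ℝ), ValidSt x none := fun x hx =>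
      ⟨hx, fun k hk => by cases hk⟩
    exact concave_iSup (convex_Ici _) (fun n => (hc n b v2 h2).2)
      (fun x hx => hm x _ b (hv x hx)) (fun x hx => hb x _ b (hv x hx))
end
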